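/- Confluence of parallel reduction: for φ-terms t, u, v, if t ⇛* u and t ⇛* v (where ⇛* is the reflexive-transitive closure of parallel reduction ⇛) then there exists a φ-term w such that u ⇛* w and v ⇛* w. -/

import Mathlib

namespace PhiCalc

/-- φ-terms over a set of attribute labels `L`. An object term carries a finite
list of attributes: `(a, none)` is a void attribute, `(b, some t)` is an
attached attribute. -/
inductive Tm (L : Type) : Type where
  | loc : Nat → Tm L
  | dot : Tm L → L → Tm L
  | app : Tm L → L → Tm L → Tm L
  | obj : List (L × Option (Tm L)) → Tm L

namespace Tm

variable {L : Type}

/-- Look up a label among the attributes of an object: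
`none` = the label is missing, `some none` = void attribute,
`some (some t)` = attribute attached to `t`. -/
def lookupAttr [DecidableEq L] (a : L) : List (L × Option (Tm L)) → Option (Option (Tm L))
  | [] => none
  | (b, o) :: rest => if a = b then some o else lookupAttr a rest

/-- Attach term `u` to the (first occurrence of) label `a`. -/
def attachAttr [DecidableEq L] (a : L) (u : Tm L) :
    List (L × Option (Tm L)) → List (L × Option (Tm L))
  | [] => []
  | (b, o) :: rest => if a = b then (b, some u) :: rest else (b, o) :: attachAttr a u rest

mutual
/-- Locator increment `↑ₙ t`. -/
def incAt : Nat → Tm L → Tm L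
  | n, loc m => if m < n then loc m else loc (m + 1)
  | n, dot t a => dot (incAt n t) a
  | n, app t a u => app (incAt n t) a (incAt n u)
  | n, obj attrs => obj (incAtList (n + 1) attrs)

def incAtList : Nat → List (L × Option (Tm L)) → List (L × Option (Tm L))
  | _, [] => []
  | n, (a, none) :: rest => (a, none) :: incAtList n rest
  | n, (a, some t) :: rest => (a, some (incAt n t)) :: incAtList n rest
end

mutual
/-- Locator substitution `t[ρ^n ↦ u]`. -/
def subst : Tm L → Nat → Tm L → Tm L
  | loc m, n, u => if m < n then loc m else if m = n then u else loc (m - 1)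
  | dot t a, n, u => dot (subst t n u) a
  | app t a v, n, u => app (subst t n u) a (subst v n u)
  | obj attrs, n, u => obj (substList attrs (n + 1) (incAt 0 u))

def substList : List (L × Option (Tm L)) → Nat → Tm L → List (L × Option (Tm L))
  | [], _, _ => []
  | (a, none) :: rest, n, u => (a, none) :: substList rest n u
  | (a, some t) :: rest, n, u => (a, some (subst t n u)) :: substList rest n u
end

section Reductions

variable [DecidableEq L]

/-- One-step (regular) reduction `⇝`, parametrized by the decorator label `phi`. -/
inductive Step (phi : L) : Tm L → Tm L → Prop where
  | congObj {t t' : Tm L} (pre post : List (L × Option (Tm L))) (b : L) :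
      Step phi t t' →
      Step phi (obj (pre ++ (b, some t) :: post)) (obj (pre ++ (b, some t') :: post))
  | congDot {t t' : Tm L} (a : L) : Step phi t t' → Step phi (dot t a) (dot t' a)
  | congAppL {t t' u : Tm L} (a : L) : Step phi t t' → Step phi (app t a u) (app t' a u)
  | congAppR {t u u' : Tm L} (a : L) : Step phi u u' → Step phi (app t a u) (app t a u')
  | dotStep {attrs : List (L × Option (Tm L))} {c : L} {tc : Tm L} :
      lookupAttr c attrs = some (some tc) →
      Step phi (dot (obj attrs) c) (subst tc 0 (obj attrs))
  | dotPhi {attrs : List (L × Option (Tm L))} {c : L} :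
      lookupAttr c attrs = none → (lookupAttr phi attrs).isSome →
      Step phi (dot (obj attrs) c) (dot (dot (obj attrs) phi) c)
  | appStep {attrs : List (L × Option (Tm L))} {c : L} {u : Tm L} :
      lookupAttr c attrs = some none →
      Step phi (app (obj attrs) c u) (obj (attachAttr c (incAt 0 u) attrs))

mutual
/-- Parallel reduction `⇛`. -/
inductive Par (phi : L) : Tm L → Tm L → Prop where
  | loc (n : Nat) : Par phi (Tm.loc n) (Tm.loc n)
  | obj {attrs attrs' : List (L × Option (Tm L))} :
      ParAttrs phi attrs attrs' → Par phi (Tm.obj attrs) (Tm.obj attrs')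
  | congDot {t t' : Tm L} (a : L) : Par phi t t' → Par phi (Tm.dot t a) (Tm.dot t' a)
  | congApp {t t' u u' : Tm L} (a : L) :
      Par phi t t' → Par phi u u' → Par phi (Tm.app t a u) (Tm.app t' a u')
  | dotPar {t : Tm L} {attrs : List (L × Option (Tm L))} {c : L} {tc : Tm L} :
      Par phi t (Tm.obj attrs) → lookupAttr c attrs = some (some tc) →
      Par phi (Tm.dot t c) (subst tc 0 (Tm.obj attrs))
  | dotPhi {t : Tm L} {attrs : List (L × Option (Tm L))} {c : L} :
      Par phi t (Tm.obj attrs) → lookupAttr c attrs = none →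
      (lookupAttr phi attrs).isSome →
      Par phi (Tm.dot t c) (Tm.dot (Tm.dot (Tm.obj attrs) phi) c)
  | appPar {t : Tm L} {attrs : List (L × Option (Tm L))} {c : L} {u u' : Tm L} :
      Par phi t (Tm.obj attrs) → lookupAttr c attrs = some none → Par phi u u' →
      Par phi (Tm.app t c u) (Tm.obj (attachAttr c (incAt 0 u') attrs))

/-- Pointwise parallel reduction on attribute lists: void attributes are kept,
attached attributes reduce in parallel. -/
inductive ParAttrs (phi : L) :
    List (L × Option (Tm L)) → List (L × Option (Tm L)) → Prop where
  | nil : ParAttrs phi [] []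
  | void {rest rest' : List (L × Option (Tm L))} (a : L) :
      ParAttrs phi rest rest' → ParAttrs phi ((a, none) :: rest) ((a, none) :: rest')
  | attached {t t' : Tm L} {rest rest' : List (L × Option (Tm L))} (a : L) :
      Par phi t t' → ParAttrs phi rest rest' →
      ParAttrs phi ((a, some t) :: rest) ((a, some t') :: rest')
end

/-- Head reduction `→h`. -/
inductive Head (phi : L) : Tm L → Tm L → Prop where
  | dotStep {attrs : List (L × Option (Tm L))} {c : L} {tc : Tm L} :
      lookupAttr c attrs = some (some tc) →
      Head phi (dot (obj attrs) c) (subst tc 0 (obj attrs))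
  | dotPhi {attrs : List (L × Option (Tm L))} {c : L} :
      lookupAttr c attrs = none → (lookupAttr phi attrs).isSome →
      Head phi (dot (obj attrs) c) (dot (dot (obj attrs) phi) c)
  | appStep {attrs : List (L × Option (Tm L))} {c : L} {u : Tm L} :
      lookupAttr c attrs = some none →
      Head phi (app (obj attrs) c u) (obj (attachAttr c (incAt 0 u) attrs))
  | congDot {t t' : Tm L} (a : L) : Head phi t t' → Head phi (dot t a) (dot t' a)
  | congApp {t t' u : Tm L} (a : L) : Head phi t t' → Head phi (app t a u) (app t' a u)

/-- Internal parallel reduction `⇛ᵢ`. -/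
inductive ParI (phi : L) : Tm L → Tm L → Prop where
  | loc (n : Nat) : ParI phi (Tm.loc n) (Tm.loc n)
  | obj {attrs attrs' : List (L × Option (Tm L))} :
      ParAttrs phi attrs attrs' → ParI phi (Tm.obj attrs) (Tm.obj attrs')
  | congDot {t t' : Tm L} (a : L) : ParI phi t t' → ParI phi (Tm.dot t a) (Tm.dot t' a)
  | congApp {t t' u u' : Tm L} (a : L) :
      ParI phi t t' → Par phi u u' → ParI phi (Tm.app t a u) (Tm.app t' a u')

/-- Internal (regular) reduction `→ᵢ`. -/
inductive StepI (phi : L) : Tm L → Tm L → Prop where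
  | congObj {t t' : Tm L} (pre post : List (L × Option (Tm L))) (b : L) :
      Step phi t t' →
      StepI phi (obj (pre ++ (b, some t) :: post)) (obj (pre ++ (b, some t') :: post))
  | congDot {t t' : Tm L} (a : L) : StepI phi t t' → StepI phi (dot t a) (dot t' a)
  | congAppL {t t' u : Tm L} (a : L) : StepI phi t t' → StepI phi (app t a u) (app t' a u)
  | congAppR {t u u' : Tm L} (a : L) : Step phi u u' → StepI phi (app t a u) (app t a u')

end Reductions

end Tm

end PhiCalc
namespace PhiCalc
namespace Tm
section Extra
variable {L : Type} [DecidableEq L]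

mutual
/-- Complete development `t⁺`. -/
def cd (phi : L) : Tm L → Tm L
  | loc n => loc n
  | dot t a =>
    match cd phi t with
    | obj attrs =>
      match lookupAttr a attrs with
      | some (some ta) => subst ta 0 (obj attrs)
      | some none => dot (obj attrs) a
      | none =>
        if (lookupAttr phi attrs).isSome then dot (dot (obj attrs) phi) a
        else dot (obj attrs) a
    | t' => dot t' a
  | app t a u =>
    match cd phi t with
    | obj attrs =>
      match lookupAttr a attrs with
      | some none => obj (attachAttr a (incAt 0 (cd phi u)) attrs)
      | _ => app (obj attrs) a (cd phi u)
    | t' => app t' a (cd phi u)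
  | obj attrs => obj (cdList phi attrs)

def cdList (phi : L) : List (L × Option (Tm L)) → List (L × Option (Tm L))
  | [] => []
  | (a, none) :: rest => (a, none) :: cdList phi rest
  | (a, some t) :: rest => (a, some (cd phi t)) :: cdList phi rest
end

/-- Head reduction as a (deterministic) partial function. -/
def headRed (phi : L) : Tm L → Option (Tm L)
  | loc _ => none
  | obj _ => none
  | dot t a =>
    match t with
    | obj attrs =>
      match lookupAttr a attrs with
      | some (some ta) => some (subst ta 0 (obj attrs))
      | some none => none
      | none =>
        if (lookupAttr phi attrs).isSome then some (dot (dot (obj attrs) phi) a)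
        else none
    | t => (headRed phi t).map (fun t' => dot t' a)
  | app t a u =>
    match t with
    | obj attrs =>
      match lookupAttr a attrs with
      | some none => some (obj (attachAttr a (incAt 0 u) attrs))
      | _ => none
    | t => (headRed phi t).map (fun t' => app t' a u)

mutual
/-- Normal order reduction `⇝ℓ` as a (deterministic) partial function:
head reduction first, otherwise reduce the leftmost subterm that reduces. -/
def nordRed (phi : L) : Tm L → Option (Tm L)
  | loc _ => none
  | dot t a =>
    match headRed phi (dot t a) with
    | some s => some s
    | none => (nordRed phi t).map (fun t' => dot t' a)
  | app t a u =>
    match headRed phi (app t a u) with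
    | some s => some s
    | none =>
      match nordRed phi t with
      | some t' => some (app t' a u)
      | none => (nordRed phi u).map (fun u' => app t a u')
  | obj attrs => (nordList phi attrs).map obj

def nordList (phi : L) : List (L × Option (Tm L)) → Option (List (L × Option (Tm L)))
  | [] => none
  | (a, none) :: rest => (nordList phi rest).map (fun rest' => (a, none) :: rest')
  | (a, some t) :: rest =>
    match nordRed phi t with
    | some t' => some ((a, some t') :: rest)
    | none => (nordList phi rest).map (fun rest' => (a, some t) :: rest')
end

/-- Normal order reduction relation. -/
def NOrd (phi : L) (t t' : Tm L) : Prop := nordRed phi t = some t'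

end Extra
end Tm
end PhiCalc
namespace PhiCalc
namespace Tm
section Confluence

variable {L : Type}

mutual
theorem incAt_incAt (k n : Nat) (h : k ≤ n) :
    ∀ t : Tm L, incAt k (incAt n t) = incAt (n + 1) (incAt k t)
  | loc m => by
    simp only [incAt]
    split_ifs <;> simp only [incAt] <;> split_ifs <;> grind
  | dot t a => by simp only [incAt, incAt_incAt k n h t]
  | app t a u => by simp only [incAt, incAt_incAt k n h t, incAt_incAt k n h u]
  | obj attrs => by
    simp only [incAt, incAtList_incAtList (k + 1) (n + 1) (Nat.succ_le_succ h) attrs]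

theorem incAtList_incAtList (k n : Nat) (h : k ≤ n) :
    ∀ l : List (L × Option (Tm L)),
      incAtList k (incAtList n l) = incAtList (n + 1) (incAtList k l)
  | [] => by simp only [incAtList]
  | (a, none) :: rest => by simp only [incAtList, incAtList_incAtList k n h rest]
  | (a, some t) :: rest => by
    simp only [incAtList, incAt_incAt k n h t, incAtList_incAtList k n h rest]
end

mutual
theorem incAt_subst_of_le (k n : Nat) (h : k ≤ n) :
    ∀ t u : Tm L, incAt k (subst t n u) = subst (incAt k t) (n + 1) (incAt k u)
  | loc m, u => by
    simp only [incAt, subst]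
    split_ifs <;> simp only [incAt, subst] <;> split_ifs <;> grind
  | dot t a, u => by simp only [incAt, subst, incAt_subst_of_le k n h t]
  | app t a v, u => by
    simp only [incAt, subst, incAt_subst_of_le k n h t, incAt_subst_of_le k n h v]
  | obj attrs, u => by
    simp only [incAt, subst, incAt_incAt 0 k (Nat.zero_le k) u,
      incAtList_substList_of_le (k + 1) (n + 1) (Nat.succ_le_succ h) attrs]

theorem incAtList_substList_of_le (k n : Nat) (h : k ≤ n) :
    ∀ (l : List (L × Option (Tm L))) (u : Tm L),
      incAtList k (substList l n u) = substList (incAtList k l) (n + 1) (incAt k u)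
  | [], u => by simp only [incAtList, substList]
  | (a, none) :: rest, u => by
    simp only [incAtList, substList, incAtList_substList_of_le k n h rest]
  | (a, some t) :: rest, u => by
    simp only [incAtList, substList, incAt_subst_of_le k n h t,
      incAtList_substList_of_le k n h rest]
end

mutual
theorem incAt_subst_of_ge (k n : Nat) (h : n ≤ k) :
    ∀ t u : Tm L, incAt k (subst t n u) = subst (incAt (k + 1) t) n (incAt k u)
  | loc m, u => by
    simp only [incAt, subst]
    split_ifs <;> simp only [incAt, subst] <;> split_ifs <;> grind
  | dot t a, u => by simp only [incAt, subst, incAt_subst_of_ge k n h t]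
  | app t a v, u => by
    simp only [incAt, subst, incAt_subst_of_ge k n h t, incAt_subst_of_ge k n h v]
  | obj attrs, u => by
    simp only [incAt, subst, incAt_incAt 0 k (Nat.zero_le k) u,
      incAtList_substList_of_ge (k + 1) (n + 1) (Nat.succ_le_succ h) attrs]

theorem incAtList_substList_of_ge (k n : Nat) (h : n ≤ k) :
    ∀ (l : List (L × Option (Tm L))) (u : Tm L),
      incAtList k (substList l n u) = substList (incAtList (k + 1) l) n (incAt k u)
  | [], u => by simp only [incAtList, substList]
  | (a, none) :: rest, u => by
    simp only [incAtList, substList, incAtList_substList_of_ge k n h rest]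
  | (a, some t) :: rest, u => by
    simp only [incAtList, substList, incAt_subst_of_ge k n h t,
      incAtList_substList_of_ge k n h rest]
end

mutual
theorem subst_incAt (n : Nat) : ∀ t u : Tm L, subst (incAt n t) n u = t
  | loc m, u => by
    simp only [incAt]
    split_ifs <;> simp only [subst] <;> split_ifs <;> grind
  | dot t a, u => by simp only [incAt, subst, subst_incAt n t]
  | app t a v, u => by simp only [incAt, subst, subst_incAt n t, subst_incAt n v]
  | obj attrs, u => by simp only [incAt, subst, substList_incAtList (n + 1) attrs]

theorem substList_incAtList (n : Nat) :
    ∀ (l : List (L × Option (Tm L))) (u : Tm L), substList (incAtList n l) n u = l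
  | [], u => by simp only [incAtList, substList]
  | (a, none) :: rest, u => by simp only [incAtList, substList, substList_incAtList n rest]
  | (a, some t) :: rest, u => by
    simp only [incAtList, substList, subst_incAt n t, substList_incAtList n rest]
end

mutual
theorem subst_subst (m n : Nat) (h : m ≤ n) :
    ∀ t u v : Tm L,
      subst (subst t m u) n v = subst (subst t (n + 1) (incAt m v)) m (subst u n v)
  | loc k, u, v => by
    rcases lt_trichotomy k (n + 1) with hk | hk | hk
    · simp only [subst, hk, if_true]
      split_ifs <;> simp only [subst] <;> split_ifs <;> grind
    · subst hk
      have h₁ : ¬ n + 1 < m := by omega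
      have h₂ : ¬ n + 1 = m := by omega
      simp [subst, h₁, h₂, subst_incAt]
    · have h₁ : ¬ k < m := by omega
      have h₂ : ¬ k = m := by omega
      have h₃ : ¬ k < n + 1 := by omega
      have h₄ : ¬ k = n + 1 := by omega
      have h₅ : ¬ k - 1 < m := by omega
      have h₆ : ¬ k - 1 = m := by omega
      have h₇ : ¬ k - 1 < n := by omega
      have h₈ : ¬ k - 1 = n := by omega
      simp only [subst, if_neg, h₁, h₂, h₃, h₄, h₅, h₆, h₇, h₈, not_false_eq_true]
  | dot t a, u, v => by simp only [subst, subst_subst m n h t]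
  | app t a w, u, v => by
    simp only [subst, subst_subst m n h t, subst_subst m n h w]
  | obj attrs, u, v => by
    simp only [subst, incAt_incAt 0 m (Nat.zero_le m) v,
      incAt_subst_of_le 0 n (Nat.zero_le n) u,
      substList_substList (m + 1) (n + 1) (Nat.succ_le_succ h) attrs]

theorem substList_substList (m n : Nat) (h : m ≤ n) :
    ∀ (l : List (L × Option (Tm L))) (u v : Tm L),
      substList (substList l m u) n v =
        substList (substList l (n + 1) (incAt m v)) m (subst u n v)
  | [], u, v => by simp only [substList]
  | (a, none) :: rest, u, v => by simp only [substList, substList_substList m n h rest]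
  | (a, some t) :: rest, u, v => by
    simp only [substList, subst_subst m n h t, substList_substList m n h rest]
end

variable [DecidableEq L]

theorem lookupAttr_incAtList (c : L) (n : Nat) :
    ∀ l : List (L × Option (Tm L)),
      lookupAttr c (incAtList n l) = (lookupAttr c l).map (Option.map (incAt n))
  | [] => by simp [incAtList, lookupAttr]
  | (b, none) :: rest => by
    simp only [incAtList, lookupAttr, lookupAttr_incAtList c n rest]
    split_ifs <;> rfl
  | (b, some t) :: rest => by
    simp only [incAtList, lookupAttr, lookupAttr_incAtList c n rest]
    split_ifs <;> rfl

theorem lookupAttr_substList (c : L) (n : Nat) (u : Tm L) :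
    ∀ l : List (L × Option (Tm L)),
      lookupAttr c (substList l n u) =
        (lookupAttr c l).map (Option.map fun t => subst t n u)
  | [] => by simp [substList, lookupAttr]
  | (b, none) :: rest => by
    simp only [substList, lookupAttr, lookupAttr_substList c n u rest]
    split_ifs <;> rfl
  | (b, some t) :: rest => by
    simp only [substList, lookupAttr, lookupAttr_substList c n u rest]
    split_ifs <;> rfl

theorem incAtList_attachAttr (c : L) (n : Nat) (w : Tm L) :
    ∀ l : List (L × Option (Tm L)),
      incAtList n (attachAttr c w l) = attachAttr c (incAt n w) (incAtList n l)
  | [] => by simp [incAtList, attachAttr]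
  | (b, none) :: rest => by
    simp only [incAtList, attachAttr]
    split_ifs <;> simp only [incAtList, incAtList_attachAttr c n w rest]
  | (b, some t) :: rest => by
    simp only [incAtList, attachAttr]
    split_ifs <;> simp only [incAtList, incAtList_attachAttr c n w rest]

theorem substList_attachAttr (c : L) (n : Nat) (w u : Tm L) :
    ∀ l : List (L × Option (Tm L)),
      substList (attachAttr c w l) n u = attachAttr c (subst w n u) (substList l n u)
  | [] => by simp [substList, attachAttr]
  | (b, none) :: rest => by
    simp only [substList, attachAttr]
    split_ifs <;> simp only [substList, substList_attachAttr c n w u rest]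
  | (b, some t) :: rest => by
    simp only [substList, attachAttr]
    split_ifs <;> simp only [substList, substList_attachAttr c n w u rest]

variable {phi : L}

mutual
theorem Par.refl : ∀ t : Tm L, Par phi t t
  | .loc n => .loc n
  | .dot t a => .congDot a (Par.refl t)
  | .app t a u => .congApp a (Par.refl t) (Par.refl u)
  | .obj attrs => .obj (ParAttrs.refl attrs)

theorem ParAttrs.refl : ∀ l : List (L × Option (Tm L)), ParAttrs phi l l
  | [] => .nil
  | (a, none) :: rest => .void a (ParAttrs.refl rest)
  | (a, some t) :: rest => .attached a (Par.refl t) (ParAttrs.refl rest)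
end

mutual
theorem Par.incAt : ∀ {t t' : Tm L} (n : Nat), Par phi t t' →
    Par phi (Tm.incAt n t) (Tm.incAt n t')
  | _, _, _, .loc _ => Par.refl _
  | _, _, n, .obj h => by simpa only [Tm.incAt] using Par.obj (ParAttrs.incAtList (n + 1) h)
  | _, _, n, .congDot a h => by simpa only [Tm.incAt] using Par.congDot a (Par.incAt n h)
  | _, _, n, .congApp a h₁ h₂ => by
    simpa only [Tm.incAt] using Par.congApp a (Par.incAt n h₁) (Par.incAt n h₂)
  | _, _, n, .dotPar h hc => by
    have ih := Par.incAt n h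
    rw [incAt_subst_of_ge n 0 (Nat.zero_le n)]
    simp only [Tm.incAt] at ih ⊢
    exact .dotPar ih (by simp [lookupAttr_incAtList, hc])
  | _, _, n, .dotPhi h hc hphi => by
    have ih := Par.incAt n h
    simp only [Tm.incAt] at ih ⊢
    exact .dotPhi ih (by simp [lookupAttr_incAtList, hc])
      (by simpa [lookupAttr_incAtList] using hphi)
  | _, _, n, .appPar h hc hu => by
    have ih := Par.incAt n h
    simp only [Tm.incAt, incAtList_attachAttr] at ih ⊢
    rw [← incAt_incAt 0 n (Nat.zero_le n)]
    exact .appPar ih (by simp [lookupAttr_incAtList, hc]) (Par.incAt n hu)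

theorem ParAttrs.incAtList : ∀ {l l' : List (L × Option (Tm L))} (n : Nat), ParAttrs phi l l' →
    ParAttrs phi (Tm.incAtList n l) (Tm.incAtList n l')
  | _, _, _, .nil => ParAttrs.refl _
  | _, _, n, .void a h => by
    simpa only [Tm.incAtList] using ParAttrs.void a (ParAttrs.incAtList n h)
  | _, _, n, .attached a h₁ h₂ => by
    simpa only [Tm.incAtList] using
      ParAttrs.attached a (Par.incAt n h₁) (ParAttrs.incAtList n h₂)
end

mutual
theorem Par.subst : ∀ {t t' u u' : Tm L} (n : Nat), Par phi t t' → Par phi u u' →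
    Par phi (Tm.subst t n u) (Tm.subst t' n u')
  | _, _, _, _, _, .loc _, hu => by
    simp only [Tm.subst]
    split_ifs
    · exact .loc _
    · exact hu
    · exact .loc _
  | _, _, _, _, n, .obj h, hu => by
    simpa only [Tm.subst] using Par.obj (ParAttrs.substList (n + 1) h (Par.incAt 0 hu))
  | _, _, _, _, n, .congDot a h, hu => by
    simpa only [Tm.subst] using Par.congDot a (Par.subst n h hu)
  | _, _, _, _, n, .congApp a h₁ h₂, hu => by
    simpa only [Tm.subst] using Par.congApp a (Par.subst n h₁ hu) (Par.subst n h₂ hu)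
  | _, _, _, _, n, .dotPar h hc, hu => by
    have ih := Par.subst n h hu
    rw [subst_subst 0 n (Nat.zero_le n)]
    simp only [Tm.subst] at ih ⊢
    exact .dotPar ih (by simp [lookupAttr_substList, hc])
  | _, _, _, _, n, .dotPhi h hc hphi, hu => by
    have ih := Par.subst n h hu
    simp only [Tm.subst] at ih ⊢
    exact .dotPhi ih (by simp [lookupAttr_substList, hc])
      (by simpa [lookupAttr_substList] using hphi)
  | _, _, _, _, n, .appPar h hc hw, hu => by
    have ih := Par.subst n h hu
    simp only [Tm.subst, substList_attachAttr] at ih ⊢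
    rw [← incAt_subst_of_le 0 n (Nat.zero_le n)]
    exact .appPar ih (by simp [lookupAttr_substList, hc]) (Par.subst n hw hu)

theorem ParAttrs.substList : ∀ {l l' : List (L × Option (Tm L))} {u u' : Tm L} (n : Nat),
    ParAttrs phi l l' → Par phi u u' →
    ParAttrs phi (Tm.substList l n u) (Tm.substList l' n u')
  | _, _, _, _, _, .nil, _ => by simpa only [Tm.substList] using ParAttrs.nil
  | _, _, _, _, n, .void a h, hu => by
    simpa only [Tm.substList] using ParAttrs.void a (ParAttrs.substList n h hu)
  | _, _, _, _, n, .attached a h₁ h₂, hu => by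
    simpa only [Tm.substList] using
      ParAttrs.attached a (Par.subst n h₁ hu) (ParAttrs.substList n h₂ hu)
end

theorem ParAttrs.attachAttr {l l' : List (L × Option (Tm L))} {w w' : Tm L} (c : L)
    (h : ParAttrs phi l l') (hw : Par phi w w') :
    ParAttrs phi (Tm.attachAttr c w l) (Tm.attachAttr c w' l') := by
  match h with
  | .nil => exact .nil
  | .void a h =>
    simp only [Tm.attachAttr]
    split_ifs
    · exact .attached a hw h
    · exact .void a (ParAttrs.attachAttr c h hw)
  | .attached a ht h =>
    simp only [Tm.attachAttr]
    split_ifs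
    · exact .attached a hw h
    · exact .attached a ht (ParAttrs.attachAttr c h hw)

theorem ParAttrs.lookupAttr_rel {l l' : List (L × Option (Tm L))} (c : L)
    (h : ParAttrs phi l l') :
    Option.Rel (Option.Rel (Par phi)) (lookupAttr c l) (lookupAttr c l') := by
  match h with
  | .nil => exact .none
  | .void a h =>
    simp only [lookupAttr]
    split_ifs
    · exact .some .none
    · exact ParAttrs.lookupAttr_rel c h
  | .attached a ht h =>
    simp only [lookupAttr]
    split_ifs
    · exact .some (.some ht)
    · exact ParAttrs.lookupAttr_rel c h

theorem ParAttrs.lookupAttr_eq_none {l l' : List (L × Option (Tm L))} {c : L}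
    (h : ParAttrs phi l l') (hc : lookupAttr c l = none) : lookupAttr c l' = none := by
  have hr := h.lookupAttr_rel c
  rw [hc] at hr
  generalize lookupAttr c l' = o at hr
  cases hr
  rfl

theorem ParAttrs.lookupAttr_eq_void {l l' : List (L × Option (Tm L))} {c : L}
    (h : ParAttrs phi l l') (hc : lookupAttr c l = some none) :
    lookupAttr c l' = some none := by
  have hr := h.lookupAttr_rel c
  rw [hc] at hr
  generalize lookupAttr c l' = o at hr
  cases hr with
  | some h => cases h; rfl

theorem ParAttrs.lookupAttr_eq_attached {l l' : List (L × Option (Tm L))} {c : L} {t : Tm L}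
    (h : ParAttrs phi l l') (hc : lookupAttr c l = some (some t)) :
    ∃ t', lookupAttr c l' = some (some t') ∧ Par phi t t' := by
  have hr := h.lookupAttr_rel c
  rw [hc] at hr
  generalize lookupAttr c l' = o at hr
  cases hr with
  | some h => cases h with
    | some h => exact ⟨_, rfl, h⟩

theorem ParAttrs.lookupAttr_isSome {l l' : List (L × Option (Tm L))} {c : L}
    (h : ParAttrs phi l l') (hc : (lookupAttr c l).isSome) : (lookupAttr c l').isSome := by
  have hr := h.lookupAttr_rel c
  generalize lookupAttr c l = o at hr hc
  generalize lookupAttr c l' = o' at hr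
  cases hr with
  | some _ => rfl
  | none => simp at hc

theorem Par.exists_of_obj {l : List (L × Option (Tm L))} {t : Tm L} (h : Par phi (.obj l) t) :
    ∃ l', t = .obj l' ∧ ParAttrs phi l l' := by
  cases h with
  | obj h => exact ⟨_, rfl, h⟩

mutual
/-- Every parallel reduct of `t` reduces in parallel to the complete development of `t`. -/
theorem Par.cd : ∀ {t t' : Tm L}, Par phi t t' → Par phi t' (Tm.cd phi t)
  | _, _, .loc n => by simpa only [Tm.cd] using Par.loc n
  | _, _, .obj h => by simpa only [Tm.cd] using Par.obj (ParAttrs.cdList h)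
  | _, _, .congDot a h => by
    have ih := Par.cd h
    simp only [Tm.cd]
    split
    · rename_i attrs heq
      rw [heq] at ih
      split
      · exact .dotPar ih ‹_›
      · exact .congDot a ih
      · split_ifs with hphi
        · exact .dotPhi ih ‹_› hphi
        · exact .congDot a ih
    · exact .congDot a ih
  | _, _, .congApp a h₁ h₂ => by
    have ih := Par.cd h₁
    have ih₂ := Par.cd h₂
    simp only [Tm.cd]
    split
    · rename_i attrs heq
      rw [heq] at ih
      split
      · exact .appPar ih ‹_› ih₂
      · exact .congApp a ih ih₂
    · exact .congApp a ih ih₂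
  | _, _, .dotPar h hc => by
    have ih := Par.cd h
    obtain ⟨l', heq, hl⟩ := ih.exists_of_obj
    obtain ⟨t', hc', ht⟩ := hl.lookupAttr_eq_attached hc
    simp only [Tm.cd, heq, hc']
    exact Par.subst 0 ht (.obj hl)
  | _, _, .dotPhi h hc hphi => by
    have ih := Par.cd h
    obtain ⟨l', heq, hl⟩ := ih.exists_of_obj
    simp only [Tm.cd, heq, hl.lookupAttr_eq_none hc, hl.lookupAttr_isSome hphi, if_true]
    exact .congDot _ (.congDot _ (.obj hl))
  | _, _, .appPar h hc hu => by
    have ih := Par.cd h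
    obtain ⟨l', heq, hl⟩ := ih.exists_of_obj
    simp only [Tm.cd, heq, hl.lookupAttr_eq_void hc]
    exact .obj (hl.attachAttr _ (Par.incAt 0 (Par.cd hu)))

theorem ParAttrs.cdList : ∀ {l l' : List (L × Option (Tm L))}, ParAttrs phi l l' →
    ParAttrs phi l' (Tm.cdList phi l)
  | _, _, .nil => by simpa only [Tm.cdList] using ParAttrs.nil
  | _, _, .void a h => by simpa only [Tm.cdList] using ParAttrs.void a (ParAttrs.cdList h)
  | _, _, .attached a h₁ h₂ => by
    simpa only [Tm.cdList] using ParAttrs.attached a (Par.cd h₁) (ParAttrs.cdList h₂)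
end

end Confluence
end Tm
end PhiCalc

open PhiCalc Tm in
/-- Confluence of parallel reduction. -/
theorem par_confluence {L : Type} [DecidableEq L] (phi : L) {t u v : Tm L}
    (htu : Relation.ReflTransGen (Par phi) t u)
    (htv : Relation.ReflTransGen (Par phi) t v) :
    ∃ w : Tm L, Relation.ReflTransGen (Par phi) u w ∧
      Relation.ReflTransGen (Par phi) v w := by
  exact Relation.church_rosser
    (fun a _ _ hb hc => ⟨cd phi a, .single hb.cd, .single hc.cd⟩) htu htv
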